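/- If (⟨X_i, O_i⟩)_{i∈I} is a family of Stone MV-spaces, then the product X = ∏_{i∈I} X_i, equipped with the product MV-topology, is a Stone MV-space. -/

import Mathlib

open Set

namespace MVTop

/-- Łukasiewicz truncated sum on the unit interval: `a ⊕ b = min (a + b) 1`. -/
noncomputable def mvAdd (a b : unitInterval) : unitInterval :=
  ⟨min (a.1 + b.1) 1, ⟨le_min (add_nonneg a.2.1 b.2.1) zero_le_one, min_le_right _ _⟩⟩

/-- Łukasiewicz product on the unit interval: `a ⊙ b = max (a + b - 1) 0`. -/
noncomputable def mvMul (a b : unitInterval) : unitInterval :=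
  ⟨max (a.1 + b.1 - 1) 0,
    ⟨le_max_right _ _, max_le (by nlinarith [a.2.1, a.2.2, b.2.1, b.2.2]) zero_le_one⟩⟩

variable {X Y : Type*}

/-- Pointwise truncated sum of fuzzy subsets. -/
noncomputable def fAdd (α β : X → unitInterval) : X → unitInterval := fun x => mvAdd (α x) (β x)

/-- Pointwise Łukasiewicz product of fuzzy subsets. -/
noncomputable def fMul (α β : X → unitInterval) : X → unitInterval := fun x => mvMul (α x) (β x)

/-- Pointwise minimum of fuzzy subsets. -/
noncomputable def fInf (α β : X → unitInterval) : X → unitInterval := fun x => min (α x) (β x)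

/-- Pointwise complement `α* = 1 - α`. -/
noncomputable def fStar (α : X → unitInterval) : X → unitInterval :=
  fun x => unitInterval.symm (α x)

instance : Fact ((0:ℝ) ≤ 1) := ⟨zero_le_one⟩

/-- Pointwise supremum of a family of fuzzy subsets. -/
noncomputable def fSup (Γ : Set (X → unitInterval)) : X → unitInterval :=
  fun x => ⨆ α ∈ Γ, α x

/-- The constant fuzzy subset `𝟏`. -/
noncomputable def fOne : X → unitInterval := fun _ => 1

/-- The constant fuzzy subset `𝟎`. -/
noncomputable def fZero : X → unitInterval := fun _ => 0

/-- `fNsmul n α` is the `n`-fold truncated sum `α ⊕ ⋯ ⊕ α` (with `fNsmul 0 α = 𝟎`). -/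
noncomputable def fNsmul : ℕ → (X → unitInterval) → (X → unitInterval)
  | 0, _ => fZero
  | n + 1, α => fAdd α (fNsmul n α)

/-- Truncated sum `f 0 ⊕ ⋯ ⊕ f (k-1)` of a finite family (empty sum is `𝟎`). -/
noncomputable def fSumFin : (k : ℕ) → (Fin k → (X → unitInterval)) → (X → unitInterval)
  | 0, _ => fZero
  | k + 1, f => fAdd (f 0) (fSumFin k fun i => f i.succ)

/-- Łukasiewicz product `f 0 ⊙ ⋯ ⊙ f (k-1)` of a finite family (empty product is `𝟏`). -/
noncomputable def fMulFin : (k : ℕ) → (Fin k → (X → unitInterval)) → (X → unitInterval)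
  | 0, _ => fOne
  | k + 1, f => fMul (f 0) (fMulFin k fun i => f i.succ)

/-- Pointwise minimum `f 0 ∧ ⋯ ∧ f (k-1)` of a finite family (empty infimum is `𝟏`). -/
noncomputable def fInfFin : (k : ℕ) → (Fin k → (X → unitInterval)) → (X → unitInterval)
  | 0, _ => fOne
  | k + 1, f => fInf (f 0) (fInfFin k fun i => f i.succ)

/-- `O ⊆ [0,1]^X` is an MV-topology on `X`. -/
structure IsMVTopology (O : Set (X → unitInterval)) : Prop where
  zero_mem : fZero ∈ O
  one_mem : fOne ∈ O
  sSup_mem : ∀ Γ ⊆ O, fSup Γ ∈ O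
  add_mem : ∀ o₁ ∈ O, ∀ o₂ ∈ O, fAdd o₁ o₂ ∈ O
  mul_mem : ∀ o₁ ∈ O, ∀ o₂ ∈ O, fMul o₁ o₂ ∈ O
  inf_mem : ∀ o₁ ∈ O, ∀ o₂ ∈ O, fInf o₁ o₂ ∈ O

/-- Continuity of a map between MV-topological spaces. -/
def MVContinuous (O_X : Set (X → unitInterval)) (O_Y : Set (Y → unitInterval))
    (f : X → Y) : Prop :=
  ∀ α ∈ O_Y, (fun x => α (f x)) ∈ O_X

/-- `Γ` contains an additive covering: finitely many of its elements `α i` and positive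
integers `n i` with `n 0 • α 0 ⊕ ⋯ ⊕ n (k-1) • α (k-1) = 𝟏`. -/
def ContainsAdditiveCover (Γ : Set (X → unitInterval)) : Prop :=
  ∃ (k : ℕ) (α : Fin k → X → unitInterval) (n : Fin k → ℕ),
    (∀ i, α i ∈ Γ) ∧ (∀ i, 0 < n i) ∧ fSumFin k (fun i => fNsmul (n i) (α i)) = fOne

/-- Compactness: every open covering contains an additive covering. -/
def MVCompact (O : Set (X → unitInterval)) : Prop :=
  ∀ Γ ⊆ O, fSup Γ = fOne → ContainsAdditiveCover Γ

/-- The Hausdorff separation property for MV-topologies. -/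
def MVHausdorff (O : Set (X → unitInterval)) : Prop :=
  ∀ x y : X, x ≠ y → ∃ ox ∈ O, ∃ oy ∈ O,
    ox x = 1 ∧ oy y = 1 ∧ fInf ox oy = fZero

/-- Zero-dimensionality: every open set is a supremum of clopen fuzzy subsets. -/
def MVZeroDim (O : Set (X → unitInterval)) : Prop :=
  ∀ o ∈ O, ∃ Γ : Set (X → unitInterval),
    (∀ u ∈ Γ, u ∈ O ∧ fStar u ∈ O) ∧ fSup Γ = o

/-- `GenBase S` is the smallest set containing `S` and closed under `⊕`, `⊙`, `∧`
(the base `B_S` generated by a subbase `S`). -/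
inductive GenBase (S : Set (X → unitInterval)) : (X → unitInterval) → Prop
  | base : ∀ α ∈ S, GenBase S α
  | add : ∀ α β, GenBase S α → GenBase S β → GenBase S (fAdd α β)
  | mul : ∀ α β, GenBase S α → GenBase S β → GenBase S (fMul α β)
  | inf : ∀ α β, GenBase S α → GenBase S β → GenBase S (fInf α β)

/-- `S` is a subbase for the MV-topology `O`. -/
def IsSubbase (O S : Set (X → unitInterval)) : Prop :=
  S ⊆ O ∧ ∀ α ∈ O, ∃ Γ : Set (X → unitInterval),
    (∀ β ∈ Γ, GenBase S β) ∧ fSup Γ = α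

/-- `S` is a large subbase for `O`: a subbase closed under the maps `α ↦ nα`, `n ≥ 1`. -/
def IsLargeSubbase (O S : Set (X → unitInterval)) : Prop :=
  IsSubbase O S ∧ ∀ α ∈ S, ∀ n : ℕ, 0 < n → fNsmul n α ∈ S

/-- `Θ` is a base for the MV-topology `O`. -/
def IsBase (O Θ : Set (X → unitInterval)) : Prop :=
  Θ ⊆ O ∧ ∀ α ∈ O, ∃ Γ ⊆ Θ, fSup Γ = α

/-- The collection `𝔉` of open coverings of `X` containing no additive covering. -/
def MVF (O : Set (X → unitInterval)) : Set (Set (X → unitInterval)) :=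
  {Γ | Γ ⊆ O ∧ fSup Γ = fOne ∧ ¬ ContainsAdditiveCover Γ}

/-- `M` is a maximal element of `𝔉` with respect to set inclusion. -/
def IsMaximalIn (M O : Set (X → unitInterval)) : Prop :=
  M ∈ MVF O ∧ ∀ Γ ∈ MVF O, M ⊆ Γ → Γ = M

variable {I : Type*} {Xf : I → Type*}

/-- The canonical subbase `S = {α ∘ π i : α ∈ O i, i ∈ I}` of the product MV-topology. -/
def ProdSubbase (O : ∀ i, Set (Xf i → unitInterval)) :
    Set ((∀ i, Xf i) → unitInterval) :=
  {β | ∃ i, ∃ α ∈ O i, β = fun x => α (x i)}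

/-- The product MV-topology: the smallest MV-topology containing `ProdSubbase O`. -/
def ProductMVTopology (O : ∀ i, Set (Xf i → unitInterval)) :
    Set ((∀ i, Xf i) → unitInterval) :=
  ⋂₀ {T | IsMVTopology T ∧ ProdSubbase O ⊆ T}


/-- The classical topology whose open sets are the supports of the open fuzzy subsets. -/
@[reducible]
def supportTopology {O : Set (X → unitInterval)} (hO : IsMVTopology O) : TopologicalSpace X where
  IsOpen U := ∃ α ∈ O, U = {x | 0 < α x}
  isOpen_univ := ⟨fOne, hO.one_mem, by ext; simp [fOne]⟩
  isOpen_inter := by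
    rintro _ _ ⟨α, hα, rfl⟩ ⟨β, hβ, rfl⟩
    exact ⟨fInf α β, hO.inf_mem α hα β hβ, by ext; simp [fInf]⟩
  isOpen_sUnion := by
    intro S hS
    refine ⟨fSup {α | α ∈ O ∧ {x | 0 < α x} ∈ S}, hO.sSup_mem _ fun α h => h.1, ?_⟩
    ext x
    simp only [mem_sUnion, fSup, mem_ofPred_eq, lt_iSup_iff]
    constructor
    · rintro ⟨U, hU, hx⟩
      obtain ⟨α, hα, rfl⟩ := hS U hU
      exact ⟨α, ⟨hα, hU⟩, hx⟩
    · rintro ⟨α, ⟨_, hU⟩, hx⟩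
      exact ⟨_, hU, hx⟩

theorem le_fSup {Γ : Set (X → unitInterval)} {α : X → unitInterval} (h : α ∈ Γ) (x : X) :
    α x ≤ fSup Γ x :=
  le_iSup₂ (f := fun (α : X → unitInterval) (_ : α ∈ Γ) => α x) α h

theorem lt_fSup_iff {Γ : Set (X → unitInterval)} {x : X} {t : unitInterval} :
    t < fSup Γ x ↔ ∃ α ∈ Γ, t < α x := by
  simp only [fSup, lt_iSup_iff, exists_prop]

theorem coe_fNsmul (n : ℕ) (α : X → unitInterval) (x : X) :
    (fNsmul n α x : ℝ) = min (n * (α x : ℝ)) 1 := by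
  induction n with
  | zero => simp [fNsmul, fZero]
  | succ n ih =>
    have h0 := (α x).2.1
    simp only [fNsmul, fAdd, mvAdd, ih]
    push_cast
    grind

theorem fNsmul_mem {O : Set (X → unitInterval)} (hO : IsMVTopology O) {α : X → unitInterval}
    (hα : α ∈ O) (n : ℕ) : fNsmul n α ∈ O := by
  induction n with
  | zero => exact hO.zero_mem
  | succ n ih => exact hO.add_mem _ hα _ ih

theorem mvAdd_zero_zero : mvAdd 0 0 = 0 := by
  ext; simp [mvAdd]

theorem fSumFin_eq_zero {k : ℕ} {f : Fin k → X → unitInterval} {x : X} (h : ∀ i, f i x = 0) :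
    fSumFin k f x = 0 := by
  induction k with
  | zero => rfl
  | succ k ih =>
    simp only [fSumFin, fAdd, h 0, ih fun i => h i.succ, mvAdd_zero_zero]

theorem le_mvAdd_left (a b : unitInterval) : a ≤ mvAdd a b :=
  Subtype.coe_le_coe.1 (le_min (by linarith [b.2.1]) a.2.2)

theorem le_mvAdd_right (a b : unitInterval) : b ≤ mvAdd a b :=
  Subtype.coe_le_coe.1 (le_min (by linarith [a.2.1]) b.2.2)

theorem le_fSumFin {k : ℕ} (f : Fin k → X → unitInterval) (i : Fin k) (x : X) :
    f i x ≤ fSumFin k f x := by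
  induction k with
  | zero => exact i.elim0
  | succ k ih =>
    refine Fin.cases (le_mvAdd_left _ _) (fun j => ?_) i
    exact (ih (fun i => f i.succ) j).trans (le_mvAdd_right _ _)

theorem isOpen_dyadic_lt {O : Set (X → unitInterval)} (hO : IsMVTopology O) (n k : ℕ)
    {α : X → unitInterval} (hα : α ∈ O) :
    @IsOpen X (supportTopology hO) {x | (k : ℝ) / 2 ^ n < α x} := by
  induction n generalizing k α with
  | zero =>
    rcases Nat.eq_zero_or_pos k with rfl | hk
    · exact ⟨α, hα, by simp only [Nat.cast_zero, zero_div]; rfl⟩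
    · convert @isOpen_empty X (supportTopology hO)
      refine eq_empty_of_forall_notMem fun x hx => ?_
      have h1 : (1 : ℝ) ≤ k := by exact_mod_cast hk
      simp only [pow_zero, div_one, mem_ofPred_eq] at hx
      linarith [(α x).2.2]
  | succ n ih =>
    have hp : (0 : ℝ) < 2 ^ n := by positivity
    have hdiv : (k : ℝ) / 2 ^ (n + 1) = k / 2 ^ n / 2 := by rw [pow_succ]; field_simp
    rcases lt_or_ge k (2 ^ n) with hk | hk
    · convert ih k (hO.add_mem α hα α hα) using 3 with x
      have h1 : (k : ℝ) / 2 ^ n < 1 := by rw [div_lt_one hp]; exact_mod_cast hk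
      simp only [fAdd, mvAdd, lt_min_iff, hdiv, h1, and_true]
      constructor <;> intro h <;> linarith
    · convert ih (k - 2 ^ n) (hO.mul_mem α hα α hα) using 3 with x
      have h1 : (1 : ℝ) ≤ k / 2 ^ n := by rw [one_le_div hp]; exact_mod_cast hk
      have h2 : ((k - 2 ^ n : ℕ) : ℝ) / 2 ^ n = k / 2 ^ n - 1 := by
        rw [Nat.cast_sub hk]; push_cast; field_simp
      simp only [fMul, mvMul, hdiv, h2, lt_max_iff]
      constructor
      · intro h; left; linarith
      · rintro (h | h) <;> linarith

theorem lowerSemicontinuous_of_mem {O : Set (X → unitInterval)} (hO : IsMVTopology O)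
    {α : X → unitInterval} (hα : α ∈ O) :
    @LowerSemicontinuous _ _ (supportTopology hO) _ α := by
  let _ := supportTopology hO
  intro x y hy
  have hy' : (y : ℝ) < α x := hy
  obtain ⟨n, hn⟩ := exists_pow_lt_of_lt_one (sub_pos.2 hy') (by norm_num : (1 / 2 : ℝ) < 1)
  have hp : (0 : ℝ) < 2 ^ n := by positivity
  have hle : (y : ℝ) ≤ ⌈(y : ℝ) * 2 ^ n⌉₊ / 2 ^ n := by
    rw [le_div_iff₀ hp]; exact Nat.le_ceil _
  have hlt : (⌈(y : ℝ) * 2 ^ n⌉₊ : ℝ) / 2 ^ n < α x := by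
    have h1 := Nat.ceil_lt_add_one (mul_nonneg y.2.1 hp.le)
    have h2 : (⌈(y : ℝ) * 2 ^ n⌉₊ : ℝ) / 2 ^ n < y + (1 / 2) ^ n := by
      rw [div_lt_iff₀ hp, add_mul, ← mul_pow]
      norm_num
      exact h1
    linarith
  filter_upwards [(isOpen_dyadic_lt hO n ⌈(y : ℝ) * 2 ^ n⌉₊ hα).mem_nhds hlt] with z hz
  exact Subtype.coe_lt_coe.1 (hle.trans_lt hz)

theorem compactSpace_supportTopology {O : Set (X → unitInterval)} (hO : IsMVTopology O)
    (hc : MVCompact O) : @CompactSpace X (supportTopology hO) := by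
  let _ := supportTopology hO
  refine ⟨isCompact_of_finite_subcover fun {ι} U hU hcov => ?_⟩
  choose α hα hUα using hU
  obtain ⟨k, β, m, hβ, -, hsum⟩ := hc {β | ∃ i n, β = fNsmul n (α i)}
    (by rintro _ ⟨i, n, rfl⟩; exact fNsmul_mem hO (hα i) n) (by
      funext x
      obtain ⟨i, hi⟩ := mem_iUnion.1 (hcov (mem_univ x))
      rw [hUα i] at hi
      have hpos : (0 : ℝ) < α i x := hi
      obtain ⟨n, hn⟩ := exists_nat_gt (1 / (α i x : ℝ))
      have hone : fNsmul n (α i) x = 1 := by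
        ext
        rw [coe_fNsmul]
        rw [div_lt_iff₀ hpos] at hn
        exact min_eq_right hn.le
      refine le_antisymm unitInterval.le_one' ?_
      have h := le_fSup (Γ := {β | ∃ i n, β = fNsmul n (α i)}) ⟨i, n, rfl⟩ x
      rwa [hone] at h)
  choose i n hin using hβ
  classical
  refine ⟨Finset.univ.image i, fun x _ => ?_⟩
  by_contra hx
  have hzero : ∀ j, α (i j) x = 0 := fun j => by
    by_contra h
    refine hx (mem_biUnion (Finset.mem_coe.2 (Finset.mem_image_of_mem i (Finset.mem_univ j))) ?_)
    rw [hUα (i j)]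
    exact unitInterval.pos_iff_ne_zero.2 h
  have h0 := fSumFin_eq_zero (x := x) (f := fun j => fNsmul (m j) (β j)) fun j => by
    ext
    simp [coe_fNsmul, hin, hzero]
  rw [hsum] at h0
  exact one_ne_zero h0

theorem containsAdditiveCover_of_lowerSemicontinuous [TopologicalSpace X] [CompactSpace X]
    {Γ : Set (X → unitInterval)} (hΓ : ∀ α ∈ Γ, LowerSemicontinuous α) (hcov : fSup Γ = fOne) :
    ContainsAdditiveCover Γ := by
  let h : unitInterval := ⟨1 / 2, by norm_num, by norm_num⟩
  obtain ⟨t, ht⟩ := isCompact_univ.elim_finite_subcover (fun α : Γ => α.1 ⁻¹' Ioi h)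
    (fun α => (hΓ α.1 α.2).isOpen_preimage h) (fun x _ => by
      have hx : h < fSup Γ x := by
        rw [hcov]
        exact Subtype.coe_lt_coe.1 (show (1 / 2 : ℝ) < 1 by norm_num)
      obtain ⟨α, hα, hlt⟩ := lt_fSup_iff.1 hx
      exact mem_iUnion.2 ⟨⟨α, hα⟩, hlt⟩)
  refine ⟨t.card, fun i => (t.equivFin.symm i).1.1, fun _ => 2, fun i => (t.equivFin.symm i).1.2,
    fun _ => two_pos, funext fun x => le_antisymm unitInterval.le_one' ?_⟩
  obtain ⟨α, hα, hx⟩ := mem_iUnion₂.1 (ht (mem_univ x))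
  refine le_trans ?_ (le_fSumFin _ (t.equivFin ⟨α, hα⟩) x)
  have hx' : (1 / 2 : ℝ) < α.1 x := hx
  refine Subtype.coe_le_coe.1 ?_
  simp only [Equiv.symm_apply_apply, coe_fNsmul]
  exact le_min (by push_cast [fOne]; linarith) le_rfl

theorem isMVTopology_lowerSemicontinuous [TopologicalSpace X] :
    IsMVTopology {α : X → unitInterval | LowerSemicontinuous α} where
  zero_mem := lowerSemicontinuous_const
  one_mem := lowerSemicontinuous_const
  sSup_mem _ hΓ := lowerSemicontinuous_biSup fun α hα => hΓ hα
  add_mem α hα β hβ := by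
    have h := (continuous_subtype_val.comp_lowerSemicontinuous hα (Subtype.mono_coe _)).add
      (continuous_subtype_val.comp_lowerSemicontinuous hβ (Subtype.mono_coe _))
    refine Eq.subst (motive := LowerSemicontinuous) (funext fun x => Subtype.ext ?_)
      ((continuous_projIcc (h := zero_le_one' ℝ)).comp_lowerSemicontinuous h (monotone_projIcc _))
    have := (α x).2.1
    have := (β x).2.1
    simp only [fAdd, mvAdd, Function.comp_apply, coe_projIcc]
    grind
  mul_mem α hα β hβ := by
    have h := ((continuous_subtype_val.comp_lowerSemicontinuous hα (Subtype.mono_coe _)).add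
      (continuous_subtype_val.comp_lowerSemicontinuous hβ (Subtype.mono_coe _))).add
      (lowerSemicontinuous_const (z := (-1 : ℝ)))
    refine Eq.subst (motive := LowerSemicontinuous) (funext fun x => Subtype.ext ?_)
      ((continuous_projIcc (h := zero_le_one' ℝ)).comp_lowerSemicontinuous h (monotone_projIcc _))
    have := (α x).2.2
    have := (β x).2.2
    simp only [fMul, mvMul, Function.comp_apply, coe_projIcc]
    grind
  inf_mem α hα β hβ := LowerSemicontinuous.inf hα hβ

theorem isMVTopology_sInter {𝒯 : Set (Set (X → unitInterval))} (h : ∀ T ∈ 𝒯, IsMVTopology T) :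
    IsMVTopology (⋂₀ 𝒯) where
  zero_mem T hT := (h T hT).zero_mem
  one_mem T hT := (h T hT).one_mem
  sSup_mem Γ hΓ T hT := (h T hT).sSup_mem Γ fun _ hα => hΓ hα T hT
  add_mem _ hα _ hβ T hT := (h T hT).add_mem _ (hα T hT) _ (hβ T hT)
  mul_mem _ hα _ hβ T hT := (h T hT).mul_mem _ (hα T hT) _ (hβ T hT)
  inf_mem _ hα _ hβ T hT := (h T hT).inf_mem _ (hα T hT) _ (hβ T hT)

theorem isMVTopology_productMVTopology (O : ∀ i, Set (Xf i → unitInterval)) :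
    IsMVTopology (ProductMVTopology O) :=
  isMVTopology_sInter fun _ hT => hT.1

theorem comp_eval_mem_productMVTopology {O : ∀ i, Set (Xf i → unitInterval)} {i : I}
    {α : Xf i → unitInterval} (hα : α ∈ O i) :
    (fun x : ∀ i, Xf i => α (x i)) ∈ ProductMVTopology O :=
  fun _ hT => hT.2 ⟨i, α, hα, rfl⟩

theorem mvCompact_productMVTopology {O : ∀ i, Set (Xf i → unitInterval)}
    (hO : ∀ i, IsMVTopology (O i)) (hc : ∀ i, MVCompact (O i)) :
    MVCompact (ProductMVTopology O) := by
  let _ := fun i => supportTopology (hO i)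
  have _ := fun i => compactSpace_supportTopology (hO i) (hc i)
  refine fun Γ hΓ hcov => containsAdditiveCover_of_lowerSemicontinuous (fun α hα => ?_) hcov
  refine hΓ hα {α | LowerSemicontinuous α} ⟨isMVTopology_lowerSemicontinuous, ?_⟩
  rintro _ ⟨i, β, hβ, rfl⟩
  exact LowerSemicontinuous.comp (lowerSemicontinuous_of_mem (hO i) hβ) (continuous_apply i)

theorem mvHausdorff_productMVTopology {O : ∀ i, Set (Xf i → unitInterval)}
    (hH : ∀ i, MVHausdorff (O i)) : MVHausdorff (ProductMVTopology O) := by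
  intro x y hxy
  obtain ⟨i, hi⟩ := Function.ne_iff.1 hxy
  obtain ⟨a, ha, b, hb, hax, hby, hab⟩ := hH i _ _ hi
  exact ⟨_, comp_eval_mem_productMVTopology ha, _, comp_eval_mem_productMVTopology hb, hax, hby,
    funext fun z => congrFun hab (z i)⟩

/-- The clopen fuzzy subsets. -/
def clopens (O : Set (X → unitInterval)) : Set (X → unitInterval) := {u | u ∈ O ∧ fStar u ∈ O}

theorem fStar_fStar (u : X → unitInterval) : fStar (fStar u) = u :=
  funext fun x => unitInterval.symm_symm (u x)

theorem fStar_fZero : fStar (fZero : X → unitInterval) = fOne :=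
  funext fun _ => unitInterval.symm_zero

theorem fStar_fOne : fStar (fOne : X → unitInterval) = fZero :=
  funext fun _ => unitInterval.symm_one

theorem fStar_fAdd (u v : X → unitInterval) : fStar (fAdd u v) = fMul (fStar u) (fStar v) := by
  ext x
  simp only [fStar, fAdd, fMul, mvAdd, mvMul, unitInterval.coe_symm_eq]
  grind

theorem fStar_fMul (u v : X → unitInterval) : fStar (fMul u v) = fAdd (fStar u) (fStar v) := by
  rw [← fStar_fStar (fAdd _ _), fStar_fAdd, fStar_fStar, fStar_fStar]

theorem fStar_fInf (u v : X → unitInterval) : fStar (fInf u v) = fSup {fStar u, fStar v} := by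
  funext x
  simp only [fStar, fInf, fSup, iSup_insert, iSup_singleton]
  rcases le_total (u x) (v x) with h | h
  · rw [min_eq_left h, sup_eq_left.2 (unitInterval.symm_le_symm.2 h)]
  · rw [min_eq_right h, sup_eq_right.2 (unitInterval.symm_le_symm.2 h)]

section Clopens

variable {O : Set (X → unitInterval)} {u v : X → unitInterval}

theorem fZero_mem_clopens (hO : IsMVTopology O) : fZero ∈ clopens O :=
  ⟨hO.zero_mem, fStar_fZero ▸ hO.one_mem⟩

theorem fOne_mem_clopens (hO : IsMVTopology O) : fOne ∈ clopens O :=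
  ⟨hO.one_mem, fStar_fOne ▸ hO.zero_mem⟩

theorem fAdd_mem_clopens (hO : IsMVTopology O) (hu : u ∈ clopens O) (hv : v ∈ clopens O) :
    fAdd u v ∈ clopens O :=
  ⟨hO.add_mem _ hu.1 _ hv.1, fStar_fAdd u v ▸ hO.mul_mem _ hu.2 _ hv.2⟩

theorem fMul_mem_clopens (hO : IsMVTopology O) (hu : u ∈ clopens O) (hv : v ∈ clopens O) :
    fMul u v ∈ clopens O :=
  ⟨hO.mul_mem _ hu.1 _ hv.1, fStar_fMul u v ▸ hO.add_mem _ hu.2 _ hv.2⟩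

theorem fInf_mem_clopens (hO : IsMVTopology O) (hu : u ∈ clopens O) (hv : v ∈ clopens O) :
    fInf u v ∈ clopens O :=
  ⟨hO.inf_mem _ hu.1 _ hv.1, fStar_fInf u v ▸ hO.sSup_mem _ (pair_subset hu.2 hv.2)⟩

end Clopens

/-- The fuzzy subsets that are approximated from below, at every point, by elements of `C`. -/
def approxBelow (C : Set (X → unitInterval)) : Set (X → unitInterval) :=
  {o | ∀ x, ∀ ε > (0 : ℝ), ∃ u ∈ C, (∀ y, u y ≤ o y) ∧ (o x : ℝ) - ε < u x}

theorem subset_approxBelow (C : Set (X → unitInterval)) : C ⊆ approxBelow C :=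
  fun u hu _ _ hε => ⟨u, hu, fun _ => le_rfl, sub_lt_self _ hε⟩

theorem fSup_mem_approxBelow {C Γ : Set (X → unitInterval)} (h0 : fZero ∈ C)
    (hΓ : Γ ⊆ approxBelow C) : fSup Γ ∈ approxBelow C := by
  intro x ε hε
  rcases lt_or_ge ((fSup Γ x : ℝ) - ε / 2) 0 with hlt | hge
  · exact ⟨fZero, h0, fun y => unitInterval.nonneg', by simp only [fZero, Icc.coe_zero]; linarith⟩
  · let t : unitInterval := ⟨(fSup Γ x : ℝ) - ε / 2, hge, by linarith [(fSup Γ x).2.2]⟩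
    have ht : t < fSup Γ x := Subtype.coe_lt_coe.1 (sub_lt_self _ (half_pos hε))
    obtain ⟨α, hα, hlt⟩ := lt_fSup_iff.1 ht
    obtain ⟨u, hu, hle, hux⟩ := hΓ hα x (ε / 2) (half_pos hε)
    refine ⟨u, hu, fun y => (hle y).trans (le_fSup hα y), ?_⟩
    have : (fSup Γ x : ℝ) - ε / 2 < α x := hlt
    linarith

theorem exists_fSup_eq_of_mem_approxBelow {C : Set (X → unitInterval)} {o : X → unitInterval}
    (ho : o ∈ approxBelow C) : ∃ Γ ⊆ C, fSup Γ = o := by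
  refine ⟨{u | u ∈ C ∧ ∀ y, u y ≤ o y}, fun u hu => hu.1, funext fun x => le_antisymm
    (iSup₂_le fun u hu => hu.2 x) (Subtype.coe_le_coe.1 (le_of_forall_pos_sub_le fun ε hε => ?_))⟩
  obtain ⟨u, hu, hle, hux⟩ := ho x ε hε
  exact hux.le.trans (le_fSup (Γ := {u | u ∈ C ∧ ∀ y, u y ≤ o y}) ⟨hu, hle⟩ x)

theorem binop_mem_approxBelow {C : Set (X → unitInterval)}
    {op : unitInterval → unitInterval → unitInterval}
    (hC : ∀ u ∈ C, ∀ v ∈ C, (fun x => op (u x) (v x)) ∈ C)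
    (hmono : ∀ {a b c d}, a ≤ c → b ≤ d → op a b ≤ op c d)
    (hlip : ∀ {a b c d}, a ≤ c → b ≤ d → (op c d : ℝ) - op a b ≤ (c - a) + (d - b))
    {α β : X → unitInterval} (hα : α ∈ approxBelow C) (hβ : β ∈ approxBelow C) :
    (fun x => op (α x) (β x)) ∈ approxBelow C := by
  intro x ε hε
  obtain ⟨u, hu, hle, hux⟩ := hα x (ε / 2) (half_pos hε)
  obtain ⟨v, hv, hle', hvx⟩ := hβ x (ε / 2) (half_pos hε)
  refine ⟨_, hC u hu v hv, fun y => hmono (hle y) (hle' y), ?_⟩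
  have := hlip (hle x) (hle' x)
  linarith

theorem isMVTopology_approxBelow_clopens {O : Set (X → unitInterval)} (hO : IsMVTopology O) :
    IsMVTopology (approxBelow (clopens O)) where
  zero_mem := subset_approxBelow _ (fZero_mem_clopens hO)
  one_mem := subset_approxBelow _ (fOne_mem_clopens hO)
  sSup_mem _ hΓ := fSup_mem_approxBelow (fZero_mem_clopens hO) hΓ
  add_mem _ hα _ hβ := by
    refine binop_mem_approxBelow (op := mvAdd) (fun u hu v hv => fAdd_mem_clopens hO hu hv)
      ?_ ?_ hα hβ <;> intro a b c d hac hbd <;>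
      simp only [← Subtype.coe_le_coe, mvAdd] at * <;> grind
  mul_mem _ hα _ hβ := by
    refine binop_mem_approxBelow (op := mvMul) (fun u hu v hv => fMul_mem_clopens hO hu hv)
      ?_ ?_ hα hβ <;> intro a b c d hac hbd <;>
      simp only [← Subtype.coe_le_coe, mvMul] at * <;> grind
  inf_mem _ hα _ hβ := by
    refine binop_mem_approxBelow (op := min) (fun u hu v hv => fInf_mem_clopens hO hu hv)
      (fun h h' => min_le_min h h') ?_ hα hβ
    intro a b c d hac hbd
    have hac' : (a : ℝ) ≤ c := hac
    have hbd' : (b : ℝ) ≤ d := hbd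
    rcases le_total a b with h | h
    · rw [min_eq_left h]
      have : ((min c d : unitInterval) : ℝ) ≤ c := min_le_left c d
      linarith
    · rw [min_eq_right h]
      have : ((min c d : unitInterval) : ℝ) ≤ d := min_le_right c d
      linarith

theorem mvZeroDim_productMVTopology {O : ∀ i, Set (Xf i → unitInterval)}
    (hz : ∀ i, MVZeroDim (O i)) : MVZeroDim (ProductMVTopology O) := by
  have hP := isMVTopology_productMVTopology O
  refine fun o ho => exists_fSup_eq_of_mem_approxBelow
    (ho _ ⟨isMVTopology_approxBelow_clopens hP, ?_⟩)
  rintro _ ⟨i, α, hα, rfl⟩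
  obtain ⟨Γ, hΓ, rfl⟩ := hz i α hα
  have h := fSup_mem_approxBelow (Γ := (fun u (x : ∀ i, Xf i) => u (x i)) '' Γ)
    (fZero_mem_clopens hP) (by
      rintro _ ⟨u, hu, rfl⟩
      exact subset_approxBelow _ ⟨comp_eval_mem_productMVTopology (hΓ u hu).1,
        comp_eval_mem_productMVTopology (hΓ u hu).2⟩)
  have heq : (fun x : ∀ i, Xf i => fSup Γ (x i)) =
      fSup ((fun u (x : ∀ i, Xf i) => u (x i)) '' Γ) := by
    funext x
    simp only [fSup, iSup_image]
  exact heq ▸ h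

/-- the product of Stone MV-spaces (compact, Hausdorff, zero-dimensional
MV-topological spaces) is a Stone MV-space. -/
theorem product_stone {I : Type*} {Xf : I → Type*}
    (O : ∀ i, Set (Xf i → unitInterval)) (hO : ∀ i, IsMVTopology (O i))
    (hc : ∀ i, MVCompact (O i)) (hH : ∀ i, MVHausdorff (O i)) (hz : ∀ i, MVZeroDim (O i)) :
    IsMVTopology (ProductMVTopology O) ∧ MVCompact (ProductMVTopology O) ∧
      MVHausdorff (ProductMVTopology O) ∧ MVZeroDim (ProductMVTopology O) := by
  exact ⟨isMVTopology_productMVTopology O, mvCompact_productMVTopology hO hc,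
    mvHausdorff_productMVTopology hH, mvZeroDim_productMVTopology hz⟩

end MVTop
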